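/- Let δ be a J×J matrix of free polynomials, let Λ ∈ G_δ ∩ M_n^d, and let φ ∈ H^∞(G_δ). Then there exists a free polynomial p₀ ∈ P^d such that φ(x) = p₀(x) for all x ∈ V_Λ ∩ G_δ. -/

import Mathlib

/- ## Basic framework for free (nc) function theory -/

noncomputable section

/-- A point of `M_n^d`: a `d`-tuple of `n × n` complex matrices. -/
abbrev MatTuple (d n : ℕ) : Type := Fin d → Matrix (Fin n) (Fin n) ℂ

/-- Evaluation of a free polynomial `p ∈ P^d` at a `d`-tuple of `n × n` matrices:
the unital algebra homomorphism sending the `r`-th variable to `x r`. -/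
noncomputable def evalPoly {d n : ℕ} (p : FreeAlgebra ℂ (Fin d)) (x : MatTuple d n) :
    Matrix (Fin n) (Fin n) ℂ :=
  FreeAlgebra.lift ℂ x p

/-- The operator norm (`ℓ² → ℓ²`) of a square complex matrix. -/
noncomputable def opNorm {ι : Type*} [Fintype ι] [DecidableEq ι] (A : Matrix ι ι ℂ) : ℝ :=
  ‖Matrix.toEuclideanCLM (𝕜 := ℂ) A‖

/-- Evaluation of a `J × J` matrix `δ` of free polynomials at `x ∈ M_n^d`:
the `Jn × Jn` matrix whose `(i,j)` block is `δ i j` evaluated at `x`. -/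
noncomputable def evalMat {d n J : ℕ} (δ : Matrix (Fin J) (Fin J) (FreeAlgebra ℂ (Fin d)))
    (x : MatTuple d n) : Matrix (Fin J × Fin n) (Fin J × Fin n) ℂ :=
  fun a b => evalPoly (δ a.1 b.1) x a.2 b.2

/-- The basic free open set `G_δ = {x : ‖δ(x)‖ < 1}`, at matrix size `n`. -/
noncomputable def Gdel {d J : ℕ} (δ : Matrix (Fin J) (Fin J) (FreeAlgebra ℂ (Fin d))) (n : ℕ) :
    Set (MatTuple d n) :=
  {x | opNorm (evalMat δ x) < 1}

/-- Direct sum of two square complex matrices. -/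
def mdsum {m n : ℕ} (A : Matrix (Fin m) (Fin m) ℂ) (B : Matrix (Fin n) (Fin n) ℂ) :
    Matrix (Fin (m + n)) (Fin (m + n)) ℂ :=
  Matrix.reindex finSumFinEquiv finSumFinEquiv (Matrix.fromBlocks A 0 0 B)

/-- Direct sum of two tuples of matrices (coordinatewise direct sum). -/
def tdsum {d m n : ℕ} (x : MatTuple d m) (y : MatTuple d n) : MatTuple d (m + n) :=
  fun r => mdsum (x r) (y r)

/-- `φ` is an nc-function on the graded domain `D`: it preserves direct sums
and similarities. -/
structure IsNCFn {d : ℕ} (D : ∀ n, Set (MatTuple d n))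
    (φ : ∀ n, MatTuple d n → Matrix (Fin n) (Fin n) ℂ) : Prop where
  map_dsum : ∀ {m n : ℕ} (x : MatTuple d m) (y : MatTuple d n),
      x ∈ D m → y ∈ D n → tdsum x y ∈ D (m + n) →
      φ (m + n) (tdsum x y) = mdsum (φ m x) (φ n y)
  map_sim : ∀ {n : ℕ} (x : MatTuple d n) (s : Matrix (Fin n) (Fin n) ℂ),
      IsUnit s → x ∈ D n → (fun r => s⁻¹ * x r * s) ∈ D n →
      φ n (fun r => s⁻¹ * x r * s) = s⁻¹ * φ n x * s

/-- `φ` is bounded by `C` on the graded domain `D`. -/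
def BddBy {d : ℕ} (D : ∀ n, Set (MatTuple d n))
    (φ : ∀ n, MatTuple d n → Matrix (Fin n) (Fin n) ℂ) (C : ℝ) : Prop :=
  ∀ n, ∀ x ∈ D n, opNorm (φ n x) ≤ C

/-- `D` is open in the free topology: every point has a basic free open
neighbourhood contained in `D`. -/
def IsFreeOpen {d : ℕ} (D : ∀ n, Set (MatTuple d n)) : Prop :=
  ∀ n, ∀ x ∈ D n, ∃ (J : ℕ) (δ : Matrix (Fin J) (Fin J) (FreeAlgebra ℂ (Fin d))),
    x ∈ Gdel δ n ∧ ∀ m, Gdel δ m ⊆ D m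

/-- `φ` is a free holomorphic function on the free open set `U`: every point of `U`
lies in a basic free open subset of `U` on which `φ` is a bounded nc-function. -/
def IsFreeHolo {d : ℕ} (U : ∀ n, Set (MatTuple d n))
    (φ : ∀ n, MatTuple d n → Matrix (Fin n) (Fin n) ℂ) : Prop :=
  ∀ n, ∀ x ∈ U n, ∃ (J : ℕ) (δ : Matrix (Fin J) (Fin J) (FreeAlgebra ℂ (Fin d))),
    x ∈ Gdel δ n ∧ (∀ m, Gdel δ m ⊆ U m) ∧ IsNCFn (Gdel δ) φ ∧ ∃ C, BddBy (Gdel δ) φ C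

/-- `φ` belongs to the closed unit ball of `H^∞(U)`. -/
def MemBallHinf {d : ℕ} (U : ∀ n, Set (MatTuple d n))
    (φ : ∀ n, MatTuple d n → Matrix (Fin n) (Fin n) ℂ) : Prop :=
  IsFreeHolo U φ ∧ BddBy U φ 1

/-- The variety `V_Λ` determined by `Λ` (at matrix size `m`): common zero set of
the free polynomials annihilating `Λ`. -/
def VLam {d n : ℕ} (Λ : MatTuple d n) (m : ℕ) : Set (MatTuple d m) :=
  {x | ∀ p : FreeAlgebra ℂ (Fin d), evalPoly p Λ = 0 → evalPoly p x = 0}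

end

/- ## Operator norms of block-diagonal matrices -/

lemma opNorm_mulVec_sq_le {ι : Type*} [Fintype ι] [DecidableEq ι] (A : Matrix ι ι ℂ)
    (v : ι → ℂ) :
    ∑ i, ‖(A.mulVec v) i‖ ^ 2 ≤ opNorm A ^ 2 * ∑ i, ‖v i‖ ^ 2 := by
  have h := (Matrix.toEuclideanCLM (𝕜 := ℂ) A).le_opNorm (WithLp.toLp 2 v)
  have h2 := pow_le_pow_left₀ (norm_nonneg _) h 2
  rw [mul_pow, EuclideanSpace.norm_sq_eq, EuclideanSpace.norm_sq_eq] at h2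
  exact h2

lemma opNorm_le_of_mulVec_sq_le {ι : Type*} [Fintype ι] [DecidableEq ι] (A : Matrix ι ι ℂ)
    {c : ℝ} (hc : 0 ≤ c)
    (h : ∀ v : ι → ℂ, ∑ i, ‖(A.mulVec v) i‖ ^ 2 ≤ c ^ 2 * ∑ i, ‖v i‖ ^ 2) : opNorm A ≤ c := by
  refine ContinuousLinearMap.opNorm_le_bound _ hc fun x => ?_
  refine (sq_le_sq₀ (norm_nonneg _) (by positivity)).mp ?_
  rw [mul_pow, EuclideanSpace.norm_sq_eq, EuclideanSpace.norm_sq_eq]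
  exact h x.ofLp

lemma opNorm_nonneg {ι : Type*} [Fintype ι] [DecidableEq ι] (A : Matrix ι ι ℂ) : 0 ≤ opNorm A :=
  norm_nonneg _

section BlockDiagonal

variable {ι κ σ : Type*} [Fintype ι] [Fintype κ] [Fintype σ]
  (e : ι ⊕ κ ≃ σ) (A : Matrix ι ι ℂ) (B : Matrix κ κ ℂ)

lemma blockDiag_mulVec (v : σ → ℂ) :
    (Matrix.reindex e e (Matrix.fromBlocks A 0 0 B)).mulVec v =
      Sum.elim (A.mulVec fun i => v (e (.inl i))) (B.mulVec fun j => v (e (.inr j))) ∘ e.symm := by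
  ext s
  obtain ⟨s, rfl⟩ := e.surjective s
  simp only [Matrix.mulVec, dotProduct, ← e.sum_comp, Fintype.sum_sum_type]
  cases s <;> simp [Matrix.mulVec, dotProduct]

lemma sum_blockDiag_mulVec_sq (v : σ → ℂ) :
    ∑ s, ‖((Matrix.reindex e e (Matrix.fromBlocks A 0 0 B)).mulVec v) s‖ ^ 2 =
      ∑ i, ‖(A.mulVec fun i => v (e (.inl i))) i‖ ^ 2 +
        ∑ j, ‖(B.mulVec fun j => v (e (.inr j))) j‖ ^ 2 := by
  rw [blockDiag_mulVec, ← e.sum_comp, Fintype.sum_sum_type]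
  simp

variable [DecidableEq ι] [DecidableEq κ] [DecidableEq σ]

lemma opNorm_blockDiag :
    opNorm (Matrix.reindex e e (Matrix.fromBlocks A 0 0 B)) = max (opNorm A) (opNorm B) := by
  apply le_antisymm
  · have hm : 0 ≤ max (opNorm A) (opNorm B) := le_max_of_le_left (opNorm_nonneg A)
    refine opNorm_le_of_mulVec_sq_le _ hm fun v => ?_
    rw [sum_blockDiag_mulVec_sq, ← e.sum_comp, Fintype.sum_sum_type, mul_add]
    refine add_le_add ((opNorm_mulVec_sq_le A _).trans ?_) ((opNorm_mulVec_sq_le B _).trans ?_)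
    · have := opNorm_nonneg A
      gcongr
      exact le_max_left _ _
    · have := opNorm_nonneg B
      gcongr
      exact le_max_right _ _
  · apply max_le
    · refine opNorm_le_of_mulVec_sq_le _ (opNorm_nonneg _) fun v => ?_
      have h := opNorm_mulVec_sq_le (Matrix.reindex e e (Matrix.fromBlocks A 0 0 B))
        (Sum.elim v 0 ∘ e.symm)
      rw [sum_blockDiag_mulVec_sq, ← e.sum_comp (fun s => ‖_‖ ^ 2), Fintype.sum_sum_type] at h
      simpa [Matrix.mulVec, dotProduct] using h
    · refine opNorm_le_of_mulVec_sq_le _ (opNorm_nonneg _) fun v => ?_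
      have h := opNorm_mulVec_sq_le (Matrix.reindex e e (Matrix.fromBlocks A 0 0 B))
        (Sum.elim 0 v ∘ e.symm)
      rw [sum_blockDiag_mulVec_sq, ← e.sum_comp (fun s => ‖_‖ ^ 2), Fintype.sum_sum_type] at h
      simpa [Matrix.mulVec, dotProduct] using h

end BlockDiagonal

/- ## Evaluation of free polynomials -/

section Evaluation

variable {d : ℕ}

lemma mdsum_add {m n : ℕ} (A A' : Matrix (Fin m) (Fin m) ℂ) (B B' : Matrix (Fin n) (Fin n) ℂ) :
    mdsum (A + A') (B + B') = mdsum A B + mdsum A' B' := by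
  have h := Matrix.fromBlocks_add A 0 0 B A' 0 0 B'
  simp only [add_zero] at h
  simp only [mdsum, ← h]
  rfl

lemma mdsum_mul {m n : ℕ} (A A' : Matrix (Fin m) (Fin m) ℂ) (B B' : Matrix (Fin n) (Fin n) ℂ) :
    mdsum (A * A') (B * B') = mdsum A B * mdsum A' B' := by
  simp [mdsum, Matrix.fromBlocks_multiply, Matrix.submatrix_mul_equiv]

lemma mdsum_algebraMap (m n : ℕ) (c : ℂ) :
    mdsum (algebraMap ℂ (Matrix (Fin m) (Fin m) ℂ) c) (algebraMap ℂ (Matrix (Fin n) (Fin n) ℂ) c) =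
      algebraMap ℂ _ c := by
  simp [mdsum, Matrix.algebraMap_eq_diagonal, Matrix.fromBlocks_diagonal, Pi.algebraMap_def,
    Function.comp_def]

lemma mdsum_injective {m n : ℕ} {A A' : Matrix (Fin m) (Fin m) ℂ}
    {B B' : Matrix (Fin n) (Fin n) ℂ} (h : mdsum A B = mdsum A' B') : A = A' ∧ B = B' := by
  have h' := (Matrix.reindex finSumFinEquiv finSumFinEquiv).injective h
  rw [Matrix.fromBlocks_inj] at h'
  exact ⟨h'.1, h'.2.2.2⟩

lemma evalPoly_tdsum {m n : ℕ} (p : FreeAlgebra ℂ (Fin d)) (x : MatTuple d m)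
    (y : MatTuple d n) : evalPoly p (tdsum x y) = mdsum (evalPoly p x) (evalPoly p y) := by
  unfold evalPoly
  induction p with
  | grade0 c => simp only [AlgHom.commutes, mdsum_algebraMap]
  | grade1 r => simp [tdsum]
  | mul a b ha hb => simp only [map_mul, ha, hb, mdsum_mul]
  | add a b ha hb => simp only [map_add, ha, hb, mdsum_add]

lemma evalPoly_conj {n : ℕ} (p : FreeAlgebra ℂ (Fin d)) (x : MatTuple d n)
    {s t : Matrix (Fin n) (Fin n) ℂ} (hst : s * t = 1) (hts : t * s = 1) :
    evalPoly p (fun r => t * x r * s) = t * evalPoly p x * s := by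
  unfold evalPoly
  induction p with
  | grade0 c => rw [AlgHom.commutes, AlgHom.commutes, ← Algebra.commutes, mul_assoc, hts, mul_one]
  | grade1 r => simp
  | mul a b ha hb =>
    rw [map_mul, map_mul, ha, hb]
    calc _ = t * (FreeAlgebra.lift ℂ x a) * (s * t) * (FreeAlgebra.lift ℂ x b) * s := by
          simp only [mul_assoc]
      _ = _ := by rw [hst]; simp only [mul_assoc, mul_one]
  | add a b ha hb => simp only [map_add, ha, hb, mul_add, add_mul]

lemma tdsum_mem_Gdel_iff {J m n : ℕ} (δ : Matrix (Fin J) (Fin J) (FreeAlgebra ℂ (Fin d)))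
    (x : MatTuple d m) (y : MatTuple d n) :
    tdsum x y ∈ Gdel δ (m + n) ↔ x ∈ Gdel δ m ∧ y ∈ Gdel δ n := by
  let e : (Fin J × Fin m) ⊕ (Fin J × Fin n) ≃ Fin J × Fin (m + n) :=
    (Equiv.prodSumDistrib _ _ _).symm.trans (Equiv.prodCongr (Equiv.refl _) finSumFinEquiv)
  have h : evalMat δ (tdsum x y) =
      Matrix.reindex e e (Matrix.fromBlocks (evalMat δ x) 0 0 (evalMat δ y)) := by
    ext a b
    obtain ⟨a, rfl⟩ := e.surjective a
    obtain ⟨b, rfl⟩ := e.surjective b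
    cases a <;> cases b <;> simp [e, evalMat, evalPoly_tdsum, mdsum]
  simp only [Gdel, Set.mem_ofPred_eq, h, opNorm_blockDiag, max_lt_iff]

end Evaluation

lemma IsFreeHolo.isNCFn {d J : ℕ} {δ : Matrix (Fin J) (Fin J) (FreeAlgebra ℂ (Fin d))}
    {φ : ∀ m, MatTuple d m → Matrix (Fin m) (Fin m) ℂ} (hφ : IsFreeHolo (Gdel δ) φ) :
    IsNCFn (Gdel δ) φ where
  map_dsum x y hx hy hxy := by
    obtain ⟨J', δ', hz, -, hnc, -⟩ := hφ _ _ hxy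
    obtain ⟨hx', hy'⟩ := (tdsum_mem_Gdel_iff δ' x y).1 hz
    exact hnc.map_dsum x y hx' hy' hz
  map_sim x s hs hx hsx := by
    obtain ⟨J', δ', hz, -, hnc, -⟩ := hφ _ _ ((tdsum_mem_Gdel_iff δ x _).2 ⟨hx, hsx⟩)
    obtain ⟨hx', hy'⟩ := (tdsum_mem_Gdel_iff δ' x _).1 hz
    exact hnc.map_sim x s hs hx' hy'

/- ## Invariant subspaces -/

section Invariance

open scoped Matrix.Norms.L2Operator

lemma IsStarProjection.dilation_mul_dilation {R : Type*} [Ring R] [StarRing R] [Algebra ℂ R]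
    {P : R} (hP : IsStarProjection P) {a b : ℂ} (hab : a * b = 1) :
    (P + a • (1 - P)) * (P + b • (1 - P)) = 1 := by
  simp only [add_mul, mul_add, mul_smul_comm, smul_mul_assoc, hP.mul_one_sub_self,
    hP.one_sub_mul_self, hP.isIdempotentElem.eq, hP.one_sub.isIdempotentElem.eq,
    smul_zero, add_zero, zero_add]
  rw [smul_smul, mul_comm b a, hab, one_smul, add_sub_cancel]

lemma conj_dilation_eq {R : Type*} [Ring R] [Algebra ℂ R] {P X : R} (hX : X * P = P * X * P)
    {t : ℂ} (ht : t ≠ 0) :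
    (P + t⁻¹ • (1 - P)) * X * (P + t • (1 - P)) =
      ((1 + t) / 2) • X + ((1 - t) / 2) • ((2 * P - 1) * X * (2 * P - 1)) := by
  have e1 : (P + t⁻¹ • (1 - P)) * X * (P + t • (1 - P)) =
      P * X * P + t • (P * X * (1 - P)) + t⁻¹ • (X * P - P * X * P) +
        (t⁻¹ * t) • ((1 - P) * X * (1 - P)) := by
    simp only [add_mul, mul_add, mul_smul_comm, smul_mul_assoc, sub_mul, one_mul]
    module
  rw [e1, ← hX, sub_self, smul_zero, inv_mul_cancel₀ ht]
  have e2 : (2 * P - 1) * X * (2 * P - 1) = 4 • (P * X * P) - 2 • (P * X) - 2 • (X * P) + X := by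
    noncomm_ring
  rw [e2, ← hX]
  simp only [mul_sub, sub_mul, one_mul, mul_one, ← hX]
  module

lemma norm_conj_reflection_le {R : Type*} [CStarAlgebra R] {U X : R} (hU : U ∈ unitary R)
    {t : ℝ} (h0 : 0 ≤ t) (h1 : t ≤ 1) :
    ‖((1 + t : ℂ) / 2) • X + ((1 - t : ℂ) / 2) • (U * X * U)‖ ≤ ‖X‖ := by
  have hn : ‖U * X * U‖ = ‖X‖ := by
    rw [CStarRing.norm_mul_mem_unitary _ hU, CStarRing.norm_mem_unitary_mul _ hU]
  have ha : ‖(1 + t : ℂ) / 2‖ = (1 + t) / 2 := by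
    rw [show (1 + t : ℂ) / 2 = (((1 + t) / 2 : ℝ) : ℂ) by push_cast; rfl, Complex.norm_real,
      Real.norm_of_nonneg (by linarith)]
  have hb : ‖(1 - t : ℂ) / 2‖ = (1 - t) / 2 := by
    rw [show (1 - t : ℂ) / 2 = (((1 - t) / 2 : ℝ) : ℂ) by push_cast; rfl, Complex.norm_real,
      Real.norm_of_nonneg (by linarith)]
  refine (norm_add_le _ _).trans ?_
  rw [norm_smul, norm_smul, hn, ha, hb]
  linarith

open scoped Kronecker in
lemma conj_dilation_mem_Gdel {d J n : ℕ} {δ : Matrix (Fin J) (Fin J) (FreeAlgebra ℂ (Fin d))}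
    {w : MatTuple d n} (hw : w ∈ Gdel δ n) {P : Matrix (Fin n) (Fin n) ℂ}
    (hP : IsStarProjection P) (hinv : ∀ p, evalPoly p w * P = P * evalPoly p w * P)
    {t : ℝ} (h0 : 0 < t) (h1 : t ≤ 1) :
    (fun r => (P + (t : ℂ)⁻¹ • (1 - P)) * w r * (P + (t : ℂ) • (1 - P))) ∈ Gdel δ n := by
  have ht : (t : ℂ) ≠ 0 := by exact_mod_cast h0.ne'
  let V : Matrix (Fin J × Fin n) (Fin J × Fin n) ℂ := (1 : Matrix (Fin J) (Fin J) ℂ) ⊗ₖ (2 * P - 1)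
  have hV : V ∈ unitary (Matrix (Fin J × Fin n) (Fin J × Fin n) ℂ) :=
    Matrix.kronecker_mem_unitary (one_mem _) hP.two_mul_sub_one_mem_unitary
  have hE : evalMat δ (fun r => (P + (t : ℂ)⁻¹ • (1 - P)) * w r * (P + (t : ℂ) • (1 - P))) =
      ((1 + t : ℂ) / 2) • evalMat δ w + ((1 - t : ℂ) / 2) • (V * evalMat δ w * V) := by
    ext a b
    simp only [evalMat]
    rw [evalPoly_conj _ _ (hP.dilation_mul_dilation (mul_inv_cancel₀ ht))
      (hP.dilation_mul_dilation (inv_mul_cancel₀ ht)), conj_dilation_eq (hinv _) ht]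
    simp [V, evalMat, Matrix.mul_apply, Fintype.sum_prod_type, Matrix.one_apply]
  have := norm_conj_reflection_le (X := evalMat δ w) hV h0.le h1
  rw [← hE] at this
  exact lt_of_le_of_lt this hw

lemma IsNCFn.preserves_invariant {d J n : ℕ} {δ : Matrix (Fin J) (Fin J) (FreeAlgebra ℂ (Fin d))}
    {φ : ∀ m, MatTuple d m → Matrix (Fin m) (Fin m) ℂ} (hφ : IsNCFn (Gdel δ) φ) {C : ℝ}
    (hb : BddBy (Gdel δ) φ C) {w : MatTuple d n} (hw : w ∈ Gdel δ n)
    {P : Matrix (Fin n) (Fin n) ℂ} (hP : IsStarProjection P)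
    (hinv : ∀ p, evalPoly p w * P = P * evalPoly p w * P) :
    (1 - P) * φ n w * P = 0 := by
  have key : ∀ t : ℝ, 0 < t → t ≤ 1 → ‖(1 - P) * φ n w * P‖ ≤ t * (‖1 - P‖ * C * ‖P‖) := by
    intro t h0 h1
    have ht : (t : ℂ) ≠ 0 := by exact_mod_cast h0.ne'
    set s : Matrix (Fin n) (Fin n) ℂ := P + (t : ℂ) • (1 - P)
    have hs : s * (P + (t : ℂ)⁻¹ • (1 - P)) = 1 :=
      hP.dilation_mul_dilation (mul_inv_cancel₀ ht)
    have hs' : (P + (t : ℂ)⁻¹ • (1 - P)) * s = 1 :=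
      hP.dilation_mul_dilation (inv_mul_cancel₀ ht)
    have hsi : s⁻¹ = P + (t : ℂ)⁻¹ • (1 - P) := Matrix.inv_eq_right_inv hs
    have hmem := conj_dilation_mem_Gdel hw hP hinv h0 h1
    have hsim := hφ.map_sim w s (IsUnit.of_mul_eq_one _ hs) hw (by rw [hsi]; exact hmem)
    rw [hsi] at hsim
    have hbd := hb n _ hmem
    rw [hsim] at hbd
    have hX : (1 - P) * φ n w * P = (t : ℂ) •
        ((1 - P) * ((P + (t : ℂ)⁻¹ • (1 - P)) * φ n w * s) * P) := by
      have l : (1 - P) * (P + (t : ℂ)⁻¹ • (1 - P)) = (t : ℂ)⁻¹ • (1 - P) := by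
        simp only [mul_add, mul_smul_comm, hP.one_sub_mul_self, zero_add,
          hP.one_sub.isIdempotentElem.eq]
      have r : s * P = P := by
        simp only [s, add_mul, smul_mul_assoc, hP.one_sub_mul_self, smul_zero, add_zero,
          hP.isIdempotentElem.eq]
      simp only [← mul_assoc]
      rw [l, mul_assoc _ s P, r]
      simp only [smul_mul_assoc, smul_smul, mul_inv_cancel₀ ht, one_smul]
    rw [hX, norm_smul, Complex.norm_real, Real.norm_of_nonneg h0.le]
    gcongr
    refine (norm_mul_le _ _).trans ?_
    gcongr
    refine (norm_mul_le _ _).trans ?_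
    gcongr
    exact hbd
  have hlim : Filter.Tendsto (fun t : ℝ => t * (‖1 - P‖ * C * ‖P‖)) (nhdsWithin 0 (Set.Ioi 0))
      (nhds 0) := by
    have : Continuous fun t : ℝ => t * (‖1 - P‖ * C * ‖P‖) := by fun_prop
    simpa using (this.tendsto 0).mono_left nhdsWithin_le_nhds
  have hle : ‖(1 - P) * φ n w * P‖ ≤ 0 := by
    refine ge_of_tendsto hlim ?_
    filter_upwards [Ioc_mem_nhdsGT (zero_lt_one' ℝ)] with t ht using key t ht.1 ht.2
  exact norm_le_zero_iff.1 hle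

end Invariance

/-- Every vector has a polynomial in `w` acting on it as `φ w` does. -/
lemma IsNCFn.exists_evalPoly_mulVec_eq {d J n : ℕ}
    {δ : Matrix (Fin J) (Fin J) (FreeAlgebra ℂ (Fin d))}
    {φ : ∀ m, MatTuple d m → Matrix (Fin m) (Fin m) ℂ} (hφ : IsNCFn (Gdel δ) φ) {C : ℝ}
    (hb : BddBy (Gdel δ) φ C) {w : MatTuple d n} (hw : w ∈ Gdel δ n) (v : Fin n → ℂ) :
    ∃ p, (φ n w).mulVec v = (evalPoly p w).mulVec v := by
  let L : FreeAlgebra ℂ (Fin d) →ₗ[ℂ] EuclideanSpace ℂ (Fin n) :=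
    { toFun := fun p => WithLp.toLp 2 ((evalPoly p w).mulVec v)
      map_add' := fun p q => by simp [evalPoly, Matrix.add_mulVec]
      map_smul' := fun c p => by simp [evalPoly, Matrix.smul_mulVec] }
  let M := LinearMap.range L
  let T := Matrix.toEuclideanCLM (𝕜 := ℂ) (n := Fin n)
  let P : Matrix (Fin n) (Fin n) ℂ := T.symm M.starProjection
  have hTP : T P = M.starProjection := T.apply_symm_apply _
  have hP : IsStarProjection P := by
    have h : IsStarProjection M.starProjection := isStarProjection_starProjection
    refine ⟨EquivLike.injective T ?_, EquivLike.injective T ?_⟩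
    · rw [map_mul T, hTP, h.isIdempotentElem.eq]
    · rw [map_star T, hTP, h.isSelfAdjoint.star_eq]
  have hinv : ∀ p, evalPoly p w * P = P * evalPoly p w * P := by
    intro p
    apply EquivLike.injective T
    rw [map_mul T, map_mul T, map_mul T, hTP]
    ext1 x
    simp only [mul_apply_eq_comp]
    symm
    rw [Submodule.starProjection_eq_self_iff]
    obtain ⟨q, hq⟩ := M.starProjection_apply_mem x
    refine ⟨p * q, ?_⟩
    rw [← hq]
    simp [L, T, evalPoly]
  have hv : P.mulVec v = v := by
    have h : T P (WithLp.toLp 2 v) = WithLp.toLp 2 v := by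
      rw [hTP, Submodule.starProjection_eq_self_iff]
      exact ⟨1, by simp [L, evalPoly]⟩
    exact congrArg WithLp.ofLp h
  have hz := congrArg (fun A => A.mulVec v) (hφ.preserves_invariant hb hw hP hinv)
  simp only [← Matrix.mulVec_mulVec, hv, Matrix.sub_mulVec, Matrix.one_mulVec,
    Matrix.zero_mulVec, sub_eq_zero] at hz
  have hmem : WithLp.toLp 2 ((φ n w).mulVec v) ∈ M := by
    rw [← Submodule.starProjection_eq_self_iff, ← hTP]
    exact congrArg (WithLp.toLp 2) hz.symm
  obtain ⟨p, hp⟩ := hmem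
  exact ⟨p, congrArg WithLp.ofLp hp.symm⟩

lemma mdsum_mulVec_append {m n : ℕ} (A : Matrix (Fin m) (Fin m) ℂ) (B : Matrix (Fin n) (Fin n) ℂ)
    (u : Fin m → ℂ) (v : Fin n → ℂ) :
    (mdsum A B).mulVec (Fin.append u v) = Fin.append (A.mulVec u) (B.mulVec v) := by
  rw [mdsum, blockDiag_mulVec]
  ext i
  refine Fin.addCases (fun i => ?_) (fun i => ?_) i <;> simp

/-- Finitely many vectors can be handled at once by passing to a direct sum of copies of `z`. -/
lemma IsNCFn.exists_amplification {d J n : ℕ}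
    {δ : Matrix (Fin J) (Fin J) (FreeAlgebra ℂ (Fin d))}
    {φ : ∀ m, MatTuple d m → Matrix (Fin m) (Fin m) ℂ} (hφ : IsNCFn (Gdel δ) φ)
    {z : MatTuple d n} (hz : z ∈ Gdel δ n) (l : List (Fin n → ℂ)) :
    ∃ (N : ℕ) (w : MatTuple d N) (u : Fin N → ℂ), w ∈ Gdel δ N ∧
      ∀ p, (φ N w).mulVec u = (evalPoly p w).mulVec u →
        ∀ v ∈ l, (φ n z).mulVec v = (evalPoly p z).mulVec v := by
  induction l with
  | nil => exact ⟨n, z, 0, hz, by simp⟩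
  | cons v l ih =>
    obtain ⟨N, w, u, hw, h⟩ := ih
    have hwz := (tdsum_mem_Gdel_iff δ w z).2 ⟨hw, hz⟩
    refine ⟨N + n, tdsum w z, Fin.append u v, hwz, fun p hp => ?_⟩
    rw [hφ.map_dsum w z hw hz hwz, evalPoly_tdsum, mdsum_mulVec_append,
      mdsum_mulVec_append] at hp
    have h1 : (φ N w).mulVec u = (evalPoly p w).mulVec u := by
      ext i
      simpa using congrFun hp (Fin.castAdd n i)
    have h2 : (φ n z).mulVec v = (evalPoly p z).mulVec v := by
      ext i
      simpa using congrFun hp (Fin.natAdd N i)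
    simpa [h2] using h p h1

/-- A bounded nc-function on `G_δ` takes values in the algebra generated by the point. -/
lemma IsNCFn.exists_evalPoly_eq {d J n : ℕ} {δ : Matrix (Fin J) (Fin J) (FreeAlgebra ℂ (Fin d))}
    {φ : ∀ m, MatTuple d m → Matrix (Fin m) (Fin m) ℂ} (hφ : IsNCFn (Gdel δ) φ) {C : ℝ}
    (hb : BddBy (Gdel δ) φ C) {z : MatTuple d n} (hz : z ∈ Gdel δ n) :
    ∃ p, φ n z = evalPoly p z := by
  obtain ⟨N, w, u, hw, h⟩ :=
    hφ.exists_amplification hz (List.ofFn fun i : Fin n => Pi.single i (1 : ℂ))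
  obtain ⟨p, hp⟩ := hφ.exists_evalPoly_mulVec_eq hb hw u
  refine ⟨p, ?_⟩
  ext i j
  have := congrFun (h p hp (Pi.single j 1) (by simp)) i
  simpa using this

/-- **Lemma 3.2.**  If `φ ∈ H^∞(G_δ)` and `Λ ∈ G_δ ∩ M_n^d`, then there is a free
polynomial `p₀` with `φ(x) = p₀(x)` for every `x ∈ V_Λ ∩ G_δ`. -/
theorem exists_poly_agreeing_on_variety {d J n : ℕ} (hd : 0 < d) (hn : 0 < n)
    (δ : Matrix (Fin J) (Fin J) (FreeAlgebra ℂ (Fin d)))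
    (Λ : MatTuple d n) (hΛ : Λ ∈ Gdel δ n)
    (φ : ∀ m, MatTuple d m → Matrix (Fin m) (Fin m) ℂ)
    (hφ : IsFreeHolo (Gdel δ) φ) (hb : ∃ C : ℝ, BddBy (Gdel δ) φ C) :
    ∃ p₀ : FreeAlgebra ℂ (Fin d),
      ∀ m, ∀ x ∈ VLam Λ m ∩ Gdel δ m, φ m x = evalPoly p₀ x := by
  obtain ⟨C, hC⟩ := hb
  have hnc := hφ.isNCFn
  obtain ⟨p₀, hp₀⟩ := hnc.exists_evalPoly_eq hC hΛ
  refine ⟨p₀, fun m x hx => ?_⟩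
  have hmem := (tdsum_mem_Gdel_iff δ Λ x).2 ⟨hΛ, hx.2⟩
  obtain ⟨p, hp⟩ := hnc.exists_evalPoly_eq hC hmem
  rw [hnc.map_dsum Λ x hΛ hx.2 hmem, evalPoly_tdsum] at hp
  obtain ⟨h1, h2⟩ := mdsum_injective hp
  have h := hx.1 (p - p₀) (by simpa [evalPoly, sub_eq_zero] using h1.symm.trans hp₀)
  rw [h2]
  simpa [evalPoly, sub_eq_zero] using h
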